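/- arXiv:1801.09240 — 4 statements merged into one kernel-verified Lean document; each statement's English description precedes it below -/
import Mathlib

section
/- Let Q be a query graph and 𝔾 a streaming graph with window length |W|. If an edge σ arriving at time t_i is NOT discardable, then in the current snapshot 𝔾_{t_i} there exist a query edge ε ∈ E(Q) and a time-constrained match g of the prerequisite subquery Preq(ε) such that σ ∈ g and σ matches ε under the matching bijection of g. (Necessity direction of Lemma 1.) -/
/-- A data edge of a streaming graph: two endpoints and a timestamp. -/
structure DataEdge (V : Type*) where
  src : V
  dst : V
  time : ℝ

/-- The snapshot of a stream `S` at time `t` with window length `W`: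
the edges whose timestamps lie in `(t - W, t]`. -/
def snapshot {V : Type*} (S : Set (DataEdge V)) (t W : ℝ) : Set (DataEdge V) :=
  {σ ∈ S | t - W < σ.time ∧ σ.time ≤ t}

/-- The endpoints of a set of directed edges. -/
def endpoints {ν : Type*} (E : Set (ν × ν)) : Set ν :=
  {u | ∃ v, (u, v) ∈ E ∨ (v, u) ∈ E}

/-- A query graph: vertices, directed edges, a vertex labelling and a strict
partial order (the timing order) on the edges. -/
structure QueryGraph (ν Λ : Type*) where
  verts : Set ν
  edges : Set (ν × ν)
  edges_sub : ∀ e ∈ edges, e.1 ∈ verts ∧ e.2 ∈ verts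
  label : ν → Λ
  prec : ν × ν → ν × ν → Prop
  prec_irrefl : ∀ e, ¬ prec e e
  prec_trans : ∀ a b c, prec a b → prec b c → prec a c

/-- The subquery induced by an edge set `E'`: its vertices are the endpoints of
`E'`, its edges are `E'`, with the restrictions of the labelling and of the
timing order. -/
def QueryGraph.induced {ν Λ : Type*} (Q : QueryGraph ν Λ) (E' : Set (ν × ν)) :
    QueryGraph ν Λ where
  verts := endpoints E'
  edges := E'
  edges_sub := fun e he => ⟨⟨e.2, Or.inl he⟩, ⟨e.1, Or.inr he⟩⟩
  label := Q.label
  prec := fun a b => a ∈ E' ∧ b ∈ E' ∧ Q.prec a b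
  prec_irrefl := fun e h => Q.prec_irrefl e h.2.2
  prec_trans := fun a b c h1 h2 => ⟨h1.1, h2.2.1, Q.prec_trans a b c h1.2.2 h2.2.2⟩

/-- A time-constrained match of the query `Q` in the snapshot `s` (over a data
vertex universe labelled by `label`): an injective assignment `F` of data
vertices to query vertices preserving labels, together with an assignment `h`
of snapshot edges to query edges having the prescribed endpoints, such that the
timing order is reflected by the timestamps.  The matched subgraph is the image
`h '' Q.edges`, so that query edges correspond exactly (bijectively) to the
edges of the matched subgraph. -/
structure TCMatch {V ν Λ : Type*} (label : V → Λ) (Q : QueryGraph ν Λ)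
    (s : Set (DataEdge V)) where
  F : ν → V
  h : ν × ν → DataEdge V
  F_inj : Set.InjOn F Q.verts
  label_eq : ∀ u ∈ Q.verts, label (F u) = Q.label u
  h_mem : ∀ e ∈ Q.edges, h e ∈ s
  h_src : ∀ e ∈ Q.edges, (h e).src = F e.1
  h_dst : ∀ e ∈ Q.edges, (h e).dst = F e.2
  timing : ∀ e₁ ∈ Q.edges, ∀ e₂ ∈ Q.edges, Q.prec e₁ e₂ → (h e₁).time < (h e₂).time

/-- The prerequisite edge set of a query edge `e`:
`Preq(e) = {e' ∈ E(Q) : e' ≺ e} ∪ {e}`. -/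
def Preq {ν Λ : Type*} (Q : QueryGraph ν Λ) (e : ν × ν) : Set (ν × ν) :=
  {e' ∈ Q.edges | Q.prec e' e} ∪ {e}

/-- `Ω(Q)`: the set of time-constrained matches (as subgraphs, i.e. edge sets)
of the query `Q` in the snapshot `s`. -/
def OmegaSet {V ν Λ : Type*} (label : V → Λ) (Q : QueryGraph ν Λ)
    (s : Set (DataEdge V)) : Set (Set (DataEdge V)) :=
  {g | ∃ M : TCMatch label Q s, g = M.h '' Q.edges}

/-- Undirected adjacency via the edge set `E`. -/
def adjIn {ν : Type*} (E : Set (ν × ν)) (u v : ν) : Prop := (u, v) ∈ E ∨ (v, u) ∈ E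

/-- An edge set is weakly connected if any two of its endpoints are joined by
a path of its edges, ignoring edge directions. -/
def WeaklyConnected {ν : Type*} (E : Set (ν × ν)) : Prop :=
  ∀ u ∈ endpoints E, ∀ v ∈ endpoints E, Relation.ReflTransGen (adjIn E) u v

/-- `ε : Fin k → ν × ν` is a timing sequence of `Q`: an enumeration of all the
edges of `Q` each of whose prefixes induces a weakly connected subquery, with
`ε j ≺ ε (j+1)` for all `j`.  (`Q` is a TC-query iff it has a timing
sequence.) -/
def IsTimingSequence {ν Λ : Type*} (Q : QueryGraph ν Λ) (k : ℕ)
    (ε : Fin k → ν × ν) : Prop :=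
  Function.Injective ε ∧ Set.range ε = Q.edges ∧
    (∀ j : Fin k, WeaklyConnected (ε '' {i | i ≤ j})) ∧
    (∀ i j : Fin k, (i : ℕ) + 1 = (j : ℕ) → Q.prec (ε i) (ε j))

/-- The edge `σ` of the stream `S` is discardable (w.r.t. `Q` and window `W`)
if for every continuation of the stream by edges with timestamps greater than
`σ.time`, at no time `t' ≥ σ.time` does the snapshot contain a time-constrained
match of `Q` that includes `σ`. -/
def Discardable {V ν Λ : Type*} (label : V → Λ) (Q : QueryGraph ν Λ)
    (S : Set (DataEdge V)) (W : ℝ) (σ : DataEdge V) : Prop :=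
  ∀ S' : Set (DataEdge V), S ⊆ S' → (∀ τ ∈ S' \ S, σ.time < τ.time) →
    ∀ t' ≥ σ.time, ∀ M : TCMatch label Q (snapshot S' t' W), σ ∉ M.h '' Q.edges

/-- Matches `M₁` of the subquery induced by `E₁` and `M₂` of the subquery
induced by `E₂` are compatible if their vertex/edge assignments have a common
extension that is a time-constrained match of the subquery induced by
`E₁ ∪ E₂` (i.e. `F₁ ∪ F₂` is well-defined and `g₁ ∪ g₂` matches `Q¹ ∪ Q²`). -/
def Compatible {V ν Λ : Type*} (label : V → Λ) (Q : QueryGraph ν Λ)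
    (E₁ E₂ : Set (ν × ν)) (s : Set (DataEdge V))
    (M₁ : TCMatch label (Q.induced E₁) s) (M₂ : TCMatch label (Q.induced E₂) s) :
    Prop :=
  ∃ M : TCMatch label (Q.induced (E₁ ∪ E₂)) s,
    (∀ u ∈ endpoints E₁, M.F u = M₁.F u) ∧ (∀ u ∈ endpoints E₂, M.F u = M₂.F u) ∧
    (∀ e ∈ E₁, M.h e = M₁.h e) ∧ (∀ e ∈ E₂, M.h e = M₂.h e)

/-- The join `Ω(Q¹) ⋈ Ω(Q²)` of the match sets of the subqueries induced by
`E₁` and `E₂`: the unions `g₁ ∪ g₂` of compatible matches. -/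
def OmegaJoin {V ν Λ : Type*} (label : V → Λ) (Q : QueryGraph ν Λ)
    (E₁ E₂ : Set (ν × ν)) (s : Set (DataEdge V)) : Set (Set (DataEdge V)) :=
  {g | ∃ M₁ : TCMatch label (Q.induced E₁) s, ∃ M₂ : TCMatch label (Q.induced E₂) s,
    Compatible label Q E₁ E₂ s M₁ M₂ ∧ g = M₁.h '' E₁ ∪ M₂.h '' E₂}

/-- **Necessity direction of Lemma 1.**  Let `σ` be the edge arriving at the
current time (so every edge of the stream `S` has timestamp at most `σ.time`),
with window length `W > 0`.  If `σ` is NOT discardable, then in the current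
snapshot there exist a query edge `ε ∈ E(Q)` and a time-constrained match of
the prerequisite subquery `Preq(ε)` containing `σ`, in which `σ` matches `ε`. -/
theorem not_discardable_implies_preq_match {V ν Λ : Type*} (label : V → Λ)
    (Q : QueryGraph ν Λ) (S : Set (DataEdge V)) (W : ℝ) (hW : 0 < W)
    (σ : DataEdge V) (hσ : σ ∈ S) (hlatest : ∀ τ ∈ S, τ.time ≤ σ.time)
    (hnd : ¬ Discardable label Q S W σ) :
    ∃ ε ∈ Q.edges,
      ∃ M : TCMatch label (Q.induced (Preq Q ε)) (snapshot S σ.time W),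
        M.h ε = σ := by
  unfold Discardable at hnd
  push Not at hnd
  obtain ⟨S', -, hnew, t', ht', M, ε, hε, hMε⟩ := hnd
  have hsub : Preq Q ε ⊆ Q.edges := by
    rintro e (he | rfl)
    exacts [he.1, hε]
  have hverts : endpoints (Preq Q ε) ⊆ Q.verts := by
    rintro u ⟨v, h | h⟩
    exacts [(Q.edges_sub _ (hsub h)).1, (Q.edges_sub _ (hsub h)).2]
  have hmem : ∀ e ∈ Preq Q ε, M.h e ∈ snapshot S σ.time W := by
    rintro e (⟨he, hlt⟩ | rfl)
    · have htime : (M.h e).time < σ.time := hMε ▸ M.timing e he ε hε hlt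
      obtain ⟨hS', hwin, -⟩ := M.h_mem e he
      refine ⟨?_, by linarith, htime.le⟩
      by_contra hS
      exact lt_asymm htime (hnew _ ⟨hS', hS⟩)
    · rw [hMε]
      exact ⟨hσ, by linarith, le_rfl⟩
  exact ⟨ε, hε,
    { F := M.F
      h := M.h
      F_inj := M.F_inj.mono hverts
      label_eq := fun u hu => M.label_eq u (hverts hu)
      h_mem := hmem
      h_src := fun e he => M.h_src e (hsub he)
      h_dst := fun e he => M.h_dst e (hsub he)
      timing := fun e₁ h₁ e₂ h₂ hlt => M.timing e₁ (hsub h₁) e₂ (hsub h₂) hlt.2.2 },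
    hMε⟩
end

section
/- Let Q be a query graph, and let 𝔾 be a streaming graph with window length |W| > 0 whose timestamps are real numbers, over an infinite vertex universe in which vertices of every label occur and in which the continuation of the stream is unconstrained (any finite set of directed edges with any labels and any strictly increasing future timestamps may arrive). Suppose that at time t_i the snapshot 𝔾_{t_i} contains a time-constrained match g of the prerequisite subquery Preq(ε) for some ε ∈ E(Q), with σ ∈ g and σ matching ε under the matching bijection of g. Then σ is not discardable: there exist a time t′ > t_i and a continuation of the stream by finitely many edges with timestamps in (t_i, t′] such that the snapshot at time t′ contains a time-constrained match of the whole query Q that includes σ. (Sufficiency direction of Lemma 1.) -/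
/-- A finite injective partial choice from infinite sets extends to any larger finite set. -/
theorem exists_injOn_extension {α β : Type*} (R : α → Set β) (hR : ∀ a, (R a).Infinite)
    (f : α → β) {P B : Set α} (hP : P.Finite) (hf : Set.InjOn f P) (hfR : ∀ a ∈ P, f a ∈ R a)
    (hB : B.Finite) :
    ∃ F : α → β, Set.EqOn F f P ∧ Set.InjOn F (P ∪ B) ∧ ∀ a ∈ P ∪ B, F a ∈ R a := by
  classical
  induction B, hB using Set.Finite.induction_on with
  | empty => exact ⟨f, fun _ _ => rfl, by simpa using hf, by simpa using hfR⟩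
  | @insert a B _ hB ih =>
    obtain ⟨F, hFf, hFinj, hFR⟩ := ih
    by_cases ha : a ∈ P ∪ B
    · refine ⟨F, hFf, ?_, ?_⟩ <;> rwa [Set.union_insert, Set.insert_eq_of_mem ha]
    · obtain ⟨v, hvR, hv⟩ := ((hR a).sdiff ((hP.union hB).image F)).nonempty
      have hupd : Set.EqOn (Function.update F a v) F (P ∪ B) := fun x (hx : x ∈ P ∪ B) =>
        Function.update_of_ne (ne_of_mem_of_not_mem hx ha) _ _
      refine ⟨Function.update F a v, (hupd.mono Set.subset_union_left).trans hFf, ?_, ?_⟩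
      · rw [Set.union_insert, Set.injOn_insert ha, hupd.injOn_iff, hupd.image_eq,
          Function.update_self]
        exact ⟨hFinj, hv⟩
      · rw [Set.union_insert, Set.forall_mem_insert, Function.update_self]
        exact ⟨hvR, fun x hx => hupd hx ▸ hFR x hx⟩

/-- A strict partial order on a finite set has an injective order-preserving numbering. -/
theorem exists_injOn_nat_of_strictOrder {α : Type*} (r : α → α → Prop) (hirr : ∀ a, ¬ r a a)
    (htrans : ∀ a b c, r a b → r b c → r a c) {E : Set α} (hE : E.Finite) :
    ∃ f : α → ℕ, Set.InjOn f E ∧ ∀ a ∈ E, ∀ b ∈ E, r a b → f a < f b := by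
  obtain ⟨g, hg⟩ := Set.countable_iff_exists_injOn.1 hE.countable
  obtain ⟨N, hN⟩ := (hE.image g).bddAbove
  have hgN : ∀ a ∈ E, g a < N + 1 := fun a ha => Nat.lt_succ_of_le (hN ⟨a, ha, rfl⟩)
  let d : α → ℕ := fun a => {x ∈ E | r x a}.ncard
  have hd : ∀ a ∈ E, ∀ b, r a b → d a < d b := fun a ha b hab =>
    Set.ncard_lt_ncard ⟨fun x hx => ⟨hx.1, htrans _ _ _ hx.2 hab⟩,
      fun h => hirr a (h ⟨ha, hab⟩).2⟩ (hE.subset (Set.sep_subset _ _))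
  refine ⟨fun a => (N + 1) * d a + g a, fun a ha b hb hab => hg ha hb ?_, fun a ha b hb hab => ?_⟩
  · have h := congrArg (· % (N + 1)) hab
    simpa [Nat.mul_add_mod, Nat.mod_eq_of_lt (hgN a ha), Nat.mod_eq_of_lt (hgN b hb)] using h
  · have h₁ := hgN a ha
    have h₂ : (N + 1) * (d a + 1) ≤ (N + 1) * d b := Nat.mul_le_mul_left _ (hd a ha b hab)
    rw [Nat.mul_add] at h₂
    dsimp only
    omega

/-- **Sufficiency direction of Lemma 1.**  Let `Q` be a finite query graph over
an infinite vertex universe in which vertices of every label occur (each label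
class is infinite) and whose stream continuation is unconstrained.  Suppose the
current snapshot at time `ti` (every stream edge has timestamp `≤ ti`; window
`W > 0`) contains a time-constrained match of `Preq(ε)` for some `ε ∈ E(Q)`,
in which the stream edge `σ` matches `ε`.  Then `σ` is not discardable: there
are a time `t' > ti` and a finite continuation `T` of the stream, with pairwise
distinct timestamps in `(ti, t']`, such that the snapshot at time `t'` of the
extended stream contains a time-constrained match of the whole query `Q` that
includes `σ`. -/
theorem preq_match_implies_not_discardable {V ν Λ : Type*} (label : V → Λ)
    (Q : QueryGraph ν Λ) (hQv : Q.verts.Finite) (hQe : Q.edges.Finite)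
    (hlab : ∀ l : Λ, {v : V | label v = l}.Infinite)
    (S : Set (DataEdge V)) (W : ℝ) (hW : 0 < W)
    (ti : ℝ) (hcur : ∀ τ ∈ S, τ.time ≤ ti)
    (σ : DataEdge V) (hσ : σ ∈ S)
    (ε : ν × ν) (hε : ε ∈ Q.edges)
    (M₀ : TCMatch label (Q.induced (Preq Q ε)) (snapshot S ti W))
    (hσε : M₀.h ε = σ) :
    ∃ t' > ti, ∃ T : Set (DataEdge V), T.Finite ∧
      (∀ τ ∈ T, ti < τ.time ∧ τ.time ≤ t') ∧
      Set.InjOn DataEdge.time T ∧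
      ∃ M : TCMatch label Q (snapshot (S ∪ T) t' W), σ ∈ M.h '' Q.edges := by
  classical
  have hPE : Preq Q ε ⊆ Q.edges := by
    rintro e (he | rfl)
    exacts [he.1, hε]
  have hεP : ε ∈ Preq Q ε := Or.inr rfl
  have hPV : endpoints (Preq Q ε) ⊆ Q.verts := by
    rintro u ⟨v, h | h⟩
    exacts [(Q.edges_sub _ (hPE h)).1, (Q.edges_sub _ (hPE h)).2]
  have hdown : ∀ e ∈ Q.edges, ∀ e' ∈ Preq Q ε, Q.prec e e' → e ∈ Preq Q ε := by
    rintro e he e' (he' | rfl) h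
    exacts [Or.inl ⟨he, Q.prec_trans _ _ _ h he'.2⟩, Or.inl ⟨he, h⟩]
  obtain ⟨F, hFM, hFinj, hFlab⟩ := exists_injOn_extension
    (fun u => {v : V | label v = Q.label u}) (fun u => hlab _) M₀.F
    (hQv.subset hPV) M₀.F_inj M₀.label_eq hQv
  rw [Set.union_eq_right.2 hPV] at hFinj hFlab
  obtain ⟨f, hfinj, hfmono⟩ :=
    exists_injOn_nat_of_strictOrder Q.prec Q.prec_irrefl Q.prec_trans hQe
  obtain ⟨t', hwin, ht'⟩ : ∃ t', (∀ e ∈ Preq Q ε, t' - W < (M₀.h e).time) ∧ ti < t' := by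
    have hev : ∀ᶠ t in nhdsWithin ti (Set.Ioi ti),
        ∀ e ∈ Preq Q ε, t - W < (M₀.h e).time := by
      refine ((hQe.subset hPE).eventually_all).2 fun e he => ?_
      have hlt : ti < (M₀.h e).time + W := by linarith [(M₀.h_mem e he).2.1]
      filter_upwards [nhdsWithin_le_nhds (Iio_mem_nhds hlt)] with t ht
      exact sub_lt_iff_lt_add.2 ht
    exact (hev.and self_mem_nhdsWithin).exists
  obtain ⟨c, hcmono, hc, -⟩ := exists_seq_strictMono_tendsto' ht'
  have hold : ∀ e ∈ Preq Q ε, (M₀.h e).time ≤ ti := fun e he => (M₀.h_mem e he).2.2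
  let n : ν × ν → DataEdge V := fun e => ⟨F e.1, F e.2, c (f e)⟩
  let k : ν × ν → DataEdge V := fun e => if e ∈ Preq Q ε then M₀.h e else n e
  have hk₁ : ∀ e ∈ Preq Q ε, k e = M₀.h e := fun e he => if_pos he
  have hk₂ : ∀ e ∉ Preq Q ε, k e = n e := fun e he => if_neg he
  refine ⟨t', ht', n '' Q.edges, hQe.image n, ?_, ?_, ⟨F, k, hFinj, hFlab, ?_, ?_, ?_, ?_⟩,
    ε, hε, (hk₁ ε hεP).trans hσε⟩
  · rintro _ ⟨e, -, rfl⟩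
    exact ⟨(hc _).1, (hc _).2.le⟩
  · rintro _ ⟨e, he, rfl⟩ _ ⟨e', he', rfl⟩ h
    rw [hfinj he he' (hcmono.injective h)]
  · intro e he
    by_cases hp : e ∈ Preq Q ε
    · rw [hk₁ e hp]
      exact ⟨Or.inl (M₀.h_mem e hp).1, hwin e hp, (hold e hp).trans ht'.le⟩
    · rw [hk₂ e hp]
      exact ⟨Or.inr ⟨e, he, rfl⟩, ((hwin ε hεP).trans_le (hold ε hεP)).trans (hc _).1,
        (hc _).2.le⟩
  · intro e he
    by_cases hp : e ∈ Preq Q ε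
    · rw [hk₁ e hp, M₀.h_src e hp, hFM ⟨e.2, Or.inl hp⟩]
    · rw [hk₂ e hp]
  · intro e he
    by_cases hp : e ∈ Preq Q ε
    · rw [hk₁ e hp, M₀.h_dst e hp, hFM ⟨e.1, Or.inr hp⟩]
    · rw [hk₂ e hp]
  · intro e he e' he' h
    by_cases hp' : e' ∈ Preq Q ε
    · have hp := hdown e he e' hp' h
      rw [hk₁ e hp, hk₁ e' hp']
      exact M₀.timing e hp e' hp' ⟨hp, hp', h⟩
    · rw [hk₂ e' hp']
      by_cases hp : e ∈ Preq Q ε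
      · rw [hk₁ e hp]
        exact (hold e hp).trans_lt (hc _).1
      · rw [hk₂ e hp]
        exact hcmono (hfmono e he e' he' h)
end

section
/- Let Q be a TC-query with timing sequence ε_1, …, ε_k, and let σ be the edge with the largest timestamp in the current snapshot. Then for every j ∈ [1,k] and every time-constrained match g of the prerequisite subquery Preq(ε_j) in the snapshot with σ ∈ g, the matching bijection of g necessarily maps ε_j to σ (σ cannot match ε_i for any i < j); moreover, if j ≥ 2, then the edge set g ∖ {σ} is a time-constrained match of Preq(ε_{j−1}) in the snapshot. Consequently, the arrival of an edge σ matching query edge ε_j creates new matches only for Preq(ε_j), and every such new match has the form g′ ∪ {σ} with g′ a match of Preq(ε_{j−1}). (Theorem 2.) -/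
theorem endpoints_mono {ν : Type*} {E₁ E₂ : Set (ν × ν)} (h : E₁ ⊆ E₂) :
    endpoints E₁ ⊆ endpoints E₂ :=
  fun _ ⟨v, hv⟩ => ⟨v, hv.imp (fun h' => h h') (fun h' => h h')⟩

/-- The restriction of a match to a smaller edge set. -/
def TCMatch.restrict {V ν Λ : Type*} {label : V → Λ} {Q : QueryGraph ν Λ}
    {s : Set (DataEdge V)} {E₁ E₂ : Set (ν × ν)} (h : E₁ ⊆ E₂)
    (M : TCMatch label (Q.induced E₂) s) : TCMatch label (Q.induced E₁) s where
  F := M.F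
  h := M.h
  F_inj := M.F_inj.mono (endpoints_mono h)
  label_eq := fun u hu => M.label_eq u (endpoints_mono h hu)
  h_mem := fun e he => M.h_mem e (h he)
  h_src := fun e he => M.h_src e (h he)
  h_dst := fun e he => M.h_dst e (h he)
  timing := fun e₁ h₁ e₂ h₂ hp =>
    M.timing e₁ (h h₁) e₂ (h h₂) ⟨h h₁, h h₂, hp.2.2⟩

theorem IsTimingSequence.prec_of_lt {ν Λ : Type*} {Q : QueryGraph ν Λ} {k : ℕ}
    {ε : Fin k → ν × ν} (hts : IsTimingSequence Q k ε) {i j : Fin k} (hij : i < j) :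
    Q.prec (ε i) (ε j) := by
  obtain ⟨j, hj⟩ := j
  induction j with
  | zero => exact absurd hij (Nat.not_lt_zero _)
  | succ n ih =>
    have hstep := hts.2.2.2 ⟨n, by omega⟩ ⟨n + 1, hj⟩ rfl
    rcases Nat.lt_succ_iff_lt_or_eq.mp hij with h | h
    · exact Q.prec_trans _ _ _ (ih (by omega) h) hstep
    · rwa [show i = ⟨n, by omega⟩ from Fin.ext h]

/-- The prerequisite edges of `ε j` are the first edges of the timing sequence, up to `ε j`. -/
theorem IsTimingSequence.preq_eq {ν Λ : Type*} {Q : QueryGraph ν Λ} {k : ℕ}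
    {ε : Fin k → ν × ν} (hts : IsTimingSequence Q k ε) (j : Fin k) :
    Preq Q (ε j) = ε '' Set.Iic j := by
  ext e
  constructor
  · rintro (⟨he, hp⟩ | rfl)
    · obtain ⟨i, rfl⟩ := hts.2.1.symm ▸ he
      refine ⟨i, Set.mem_Iic.mpr (le_of_not_gt fun hji => ?_), rfl⟩
      exact Q.prec_irrefl _ (Q.prec_trans _ _ _ hp (hts.prec_of_lt hji))
    · exact ⟨j, le_refl j, rfl⟩
  · rintro ⟨i, hi, rfl⟩
    rcases (show i ≤ j from hi).lt_or_eq with h | rfl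
    · exact Or.inl ⟨hts.2.1 ▸ Set.mem_range_self i, hts.prec_of_lt h⟩
    · exact Or.inr rfl


/-- **Theorem 2.**  Let `Q` be a TC-query with timing sequence
`ε 0, …, ε (k-1)` and let `σ` be the edge with the largest timestamp in the
current snapshot `s`.  Then for every `j` and every time-constrained match of
`Preq (ε j)` in `s` containing `σ`, the matching bijection necessarily maps
`ε j` to `σ` (and `σ` cannot match `ε i` for `i < j`); moreover, if `j ≥ 1`
(i.e., `ε j` is not the first edge), removing `σ` from the match yields a
time-constrained match of `Preq (ε (j-1))` in `s`; in particular every such new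
match has the form `g' ∪ {σ}` with `g'` a match of `Preq (ε (j-1))`. -/
theorem tc_query_arrival_update {V ν Λ : Type*} (label : V → Λ)
    (Q : QueryGraph ν Λ) (k : ℕ) (ε : Fin k → ν × ν)
    (hts : IsTimingSequence Q k ε)
    (s : Set (DataEdge V)) (σ : DataEdge V) (hσ : σ ∈ s)
    (hmax : ∀ τ ∈ s, τ.time ≤ σ.time)
    (j : Fin k)
    (M : TCMatch label (Q.induced (Preq Q (ε j))) s)
    (hin : σ ∈ M.h '' Preq Q (ε j)) :
    M.h (ε j) = σ ∧
    (∀ i : Fin k, i < j → M.h (ε i) ≠ σ) ∧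
    (∀ _ : 1 ≤ (j : ℕ),
      ∃ M' : TCMatch label
          (Q.induced (Preq Q (ε ⟨(j : ℕ) - 1,
            Nat.lt_of_le_of_lt (Nat.sub_le _ _) j.isLt⟩))) s,
        M'.h '' Preq Q (ε ⟨(j : ℕ) - 1,
            Nat.lt_of_le_of_lt (Nat.sub_le _ _) j.isLt⟩) =
          (M.h '' Preq Q (ε j)) \ {σ} ∧
        M.h '' Preq Q (ε j) =
          (M'.h '' Preq Q (ε ⟨(j : ℕ) - 1,
            Nat.lt_of_le_of_lt (Nat.sub_le _ _) j.isLt⟩)) ∪ {σ}) := by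
  have hj : ε j ∈ Preq Q (ε j) := Or.inr rfl
  have hne : ∀ e ∈ Preq Q (ε j), Q.prec e (ε j) → M.h e ≠ σ := fun e he hp heq =>
    absurd (M.timing e he (ε j) hj ⟨he, hj, hp⟩) (by
      rw [heq]
      exact not_lt.mpr (hmax _ (M.h_mem _ hj)))
  have hjσ : M.h (ε j) = σ := by
    obtain ⟨e, he, heq⟩ := hin
    rcases he with he' | rfl
    · exact absurd heq (hne e (Or.inl he') he'.2)
    · exact heq
  have hlt : ∀ i : Fin k, i < j → M.h (ε i) ≠ σ := fun i hi =>
    hne _ (Or.inl ⟨hts.2.1 ▸ Set.mem_range_self i, hts.prec_of_lt hi⟩) (hts.prec_of_lt hi)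
  refine ⟨hjσ, hlt, fun h1 => ?_⟩
  generalize hp : (⟨(j : ℕ) - 1, Nat.lt_of_le_of_lt (Nat.sub_le _ _) j.isLt⟩ : Fin k) = p
  have hpj : ∀ i : Fin k, i ≤ p ↔ i < j := fun i => by
    subst hp
    simp only [Fin.le_def, Fin.lt_def]
    omega
  have hins : Preq Q (ε j) = insert (ε j) (Preq Q (ε p)) := by
    rw [hts.preq_eq, hts.preq_eq, ← Set.image_insert_eq]
    congr 1
    ext i
    simp only [Set.mem_Iic, Set.mem_insert_iff, hpj, le_iff_eq_or_lt]
  have hnot : σ ∉ M.h '' Preq Q (ε p) := by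
    rintro ⟨e, he, heq⟩
    obtain ⟨i, hi, rfl⟩ := (hts.preq_eq p).subset he
    exact hlt i ((hpj i).mp hi) heq
  have himg : M.h '' Preq Q (ε j) = insert σ (M.h '' Preq Q (ε p)) := by
    refine (congrArg (Set.image M.h) hins).trans ?_
    rw [Set.image_insert_eq, hjσ]
  refine ⟨M.restrict (hins ▸ Set.subset_insert _ _), ?_, ?_⟩
  · change M.h '' Preq Q (ε p) = _
    rw [himg, Set.insert_sdiff_self_of_notMem hnot]
  · change _ = M.h '' Preq Q (ε p) ∪ {σ}
    rw [himg, Set.union_singleton]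
end

section
/- Let S be a finite sequence (schedule) of operations, each operation tagged with a transaction index in ℕ, and let a symmetric conflict relation on operations be given. Suppose that for every pair of conflicting operations in S, the operation belonging to the transaction with the smaller index occurs earlier in S. Then S can be transformed, by a finite sequence of transpositions of adjacent non-conflicting operations, into the serial schedule in which all operations of the transaction with the smallest index come first (in their original relative order), followed by all operations of the transaction with the next index, and so on; i.e., S is conflict-equivalent to the serial schedule that executes the transactions in increasing index (chronological) order. (The abstract core of Theorem 4: the global schedule generated by the proposed locking mechanism is streaming consistent.) -/
/-- One step replacing two adjacent non-conflicting operations in a schedule. -/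
inductive SwapStep {Op : Type*} (conflict : Op → Op → Prop) : List Op → List Op → Prop
  | swap (l₁ l₂ : List Op) (a b : Op) (h : ¬ conflict a b) :
      SwapStep conflict (l₁ ++ a :: b :: l₂) (l₁ ++ b :: a :: l₂)

/-- Two schedules are conflict-equivalent if one is obtained from the other by
a finite sequence of transpositions of adjacent non-conflicting operations. -/
def ConflictEquiv {Op : Type*} (conflict : Op → Op → Prop) :
    List Op → List Op → Prop :=
  Relation.ReflTransGen (SwapStep conflict)

namespace ConflictEquiv

variable {Op : Type*} {conflict : Op → Op → Prop}

/-- Conflict-equivalence is preserved by prepending an operation. -/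
theorem cons (a : Op) {l l' : List Op} (h : ConflictEquiv conflict l l') :
    ConflictEquiv conflict (a :: l) (a :: l') := by
  refine Relation.ReflTransGen.lift (a :: ·) ?_ _ _ h
  rintro _ _ ⟨l₁, l₂, b, c, hbc⟩
  exact SwapStep.swap (a :: l₁) l₂ b c hbc

/-- An operation can be moved past a block of operations it does not conflict with. -/
theorem cons_append (a : Op) (l₁ l₂ : List Op) (h : ∀ b ∈ l₁, ¬ conflict a b) :
    ConflictEquiv conflict (a :: (l₁ ++ l₂)) (l₁ ++ a :: l₂) := by
  induction l₁ with
  | nil => exact Relation.ReflTransGen.refl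
  | cons b l₁ ih =>
    exact Relation.ReflTransGen.head (SwapStep.swap [] (l₁ ++ l₂) a b (h b (by simp)))
      ((ih fun c hc => h c (by simp [hc])).cons b)

/-- A schedule whose conflicting operations are in index order is conflict-equivalent to its
stable sort by transaction index. -/
theorem mergeSort_of_pairwise (txn : Op → ℕ) {S : List Op}
    (h : S.Pairwise fun a b => conflict a b → txn a ≤ txn b) :
    ConflictEquiv conflict S (S.mergeSort fun a b => decide (txn a ≤ txn b)) := by
  induction h with
  | nil =>
    rw [List.mergeSort_nil]
    exact Relation.ReflTransGen.refl
  | @cons a S ha _ ih =>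
    obtain ⟨l₁, l₂, hcons, hS, hlt⟩ :=
      List.mergeSort_cons (le := fun a b => decide (txn a ≤ txn b))
        (fun a b c hab hbc => by simp only [decide_eq_true_eq] at *; omega)
        (fun a b => by simpa using le_total (txn a) (txn b)) a S
    rw [hcons]
    rw [hS] at ih
    refine (ih.cons a).trans (cons_append a l₁ l₂ fun b hb hab => ?_)
    have hbS : b ∈ S := by
      rw [← List.mem_mergeSort (le := fun a b => decide (txn a ≤ txn b)), hS]
      simp [hb]
    simpa [ha b hbS hab] using hlt b hb

end ConflictEquiv

/-- **Abstract core of Theorem 4 (streaming consistency of the locking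
mechanism).**  Let `S` be a schedule of operations, each tagged with a
transaction index `txn`, with a symmetric conflict relation.  If for every pair
of conflicting operations in `S` the one of the transaction with smaller index
occurs earlier, then `S` is conflict-equivalent to the serial schedule that
executes the transactions in increasing (chronological) index order — i.e. to
the stable sort of `S` by transaction index. -/
theorem schedule_conflictEquiv_serial {Op : Type*} (txn : Op → ℕ)
    (conflict : Op → Op → Prop) (hsymm : Symmetric conflict)
    (S : List Op)
    (hord : ∀ p q : Fin S.length, p < q → conflict (S.get p) (S.get q) →
      txn (S.get p) ≤ txn (S.get q)) :
    ConflictEquiv conflict S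
      (S.mergeSort (fun a b => decide (txn a ≤ txn b))) := by
  exact ConflictEquiv.mergeSort_of_pairwise txn (List.pairwise_iff_get.mpr hord)
end
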